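/- For all integers n, k, s with 0 ≤ k ≤ n and 1 ≤ s ≤ n, it holds that C_{n,k} ≤ Σ_{i=0}^{s} [C(s,i)·C(n−s,k−i)/C(n,k)]·(C_{s,i} + C_{n−s,k−i}), where C(a,b) denotes the binomial coefficient (equal to 0 when b < 0 or b > a), and the summands with C(s,i)·C(n−s,k−i) = 0 are taken to be 0. -/

import Mathlib

open Finset

/-- Mutual information of a joint distribution `q` on `α × β`, where the output
marginal is supported inside the finite set `Ys`. Terms with zero joint
probability vanish since they are multiplied by `q x y = 0`. -/
noncomputable def MI {α : Type*} [Fintype α] {β : Type*} [DecidableEq β]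
    (q : α → β → ℝ) (Ys : Finset β) : ℝ :=
  ∑ x : α, ∑ y ∈ Ys, q x y *
    Real.logb 2 (q x y / ((∑ y' ∈ Ys, q x y') * (∑ x' : α, q x' y)))

/-- `p` is a probability distribution on the finite type `α`. -/
def IsDist {α : Type*} [Fintype α] (p : α → ℝ) : Prop :=
  (∀ a, 0 ≤ p a) ∧ ∑ a : α, p a = 1

/-- The subsequence of `x` obtained by keeping exactly the positions in `S`. -/
def delOutput {n : ℕ} (x : Fin n → Bool) (S : Finset (Fin n)) : List Bool :=
  (S.sort (· ≤ ·)).map x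

/-- All binary strings of length at most `n`. -/
def listsUpTo (n : ℕ) : Finset (List Bool) :=
  (Finset.range (n + 1)).biUnion
    (fun k => Finset.image (fun v : Fin k → Bool => List.ofFn v) Finset.univ)

/-- Transition probability of the binary deletion channel `W_n^d`:
each bit is deleted independently with probability `d`. -/
noncomputable def Wdel (n : ℕ) (d : ℝ) (x : Fin n → Bool) (y : List Bool) : ℝ :=
  ∑ S : Finset (Fin n),
    if delOutput x S = y then (1 - d) ^ S.card * d ^ (n - S.card) else 0

/-- `C_n(d)`: the supremum of `I(X;Y)` over input distributions on `{0,1}^n`,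
where `Y` is the output of the deletion channel `W_n^d` on input `X`. -/
noncomputable def Cdel (n : ℕ) (d : ℝ) : ℝ :=
  sSup { r | ∃ p : (Fin n → Bool) → ℝ, IsDist p ∧
    r = MI (fun x y => p x * Wdel n d x y) (listsUpTo n) }

/-- Transition probability of the channel `W_{n,k}` which keeps a uniformly
random `k`-element subset of the `n` positions. -/
noncomputable def Wnk (n k : ℕ) (x : Fin n → Bool) (y : List Bool) : ℝ :=
  (∑ S ∈ Finset.powersetCard k (Finset.univ : Finset (Fin n)),
      if delOutput x S = y then (1 : ℝ) else 0) / (n.choose k : ℝ)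

/-- `C_{n,k}`: the supremum of `I(X;Y)` over input distributions on `{0,1}^n`,
where `Y` is the output of `W_{n,k}` on input `X`. -/
noncomputable def Cnk (n k : ℕ) : ℝ :=
  sSup { r | ∃ p : (Fin n → Bool) → ℝ, IsDist p ∧
    r = MI (fun x y => p x * Wnk n k x y) (listsUpTo n) }

theorem MI_le_sum_logb {α β γ : Type*} [Fintype α] [DecidableEq β] {p : α → ℝ} (hp : IsDist p)
    (Γ : Finset γ) (Ys : Finset β) (f : γ → β) (hf : ∀ c ∈ Γ, f c ∈ Ys)
    (K : α → γ → ℝ) (hK0 : ∀ x c, 0 ≤ K x c) (hK1 : ∀ x, ∑ c ∈ Γ, K x c = 1)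
    (W : α → β → ℝ) (hW : ∀ x y, W x y = ∑ c ∈ Γ with f c = y, K x c)
    (ρ : γ → ℝ) (hρ0 : ∀ c, 0 ≤ ρ c) (hρ1 : ∑ c ∈ Γ, ρ c ≤ 1)
    (hac : ∀ x c, p x * K x c ≠ 0 → ρ c ≠ 0) :
    MI (fun x y => p x * W x y) Ys ≤
      ∑ x, ∑ c ∈ Γ, p x * K x c * Real.logb 2 (K x c / ρ c) := by
  obtain ⟨hp0, hp1⟩ := hp
  have hW0 : ∀ x y, 0 ≤ W x y := fun x y => by
    rw [hW]; exact sum_nonneg fun c _ => hK0 x c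
  have hrow : ∀ x, ∑ y ∈ Ys, p x * W x y = p x := fun x => by
    simp_rw [← mul_sum, hW]
    rw [sum_fiberwise_of_maps_to hf, hK1, mul_one]
  set Q : β → ℝ := fun y => ∑ x, p x * W x y with hQ
  have hQ0 : ∀ y, 0 ≤ Q y := fun y => sum_nonneg fun x _ => mul_nonneg (hp0 x) (hW0 x y)
  have hMI : MI (fun x y => p x * W x y) Ys =
      ∑ x, ∑ c ∈ Γ, p x * K x c * Real.logb 2 (p x * W x (f c) / (p x * Q (f c))) := by
    unfold MI
    refine sum_congr rfl fun x _ => ?_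
    rw [hrow x, ← sum_fiberwise_of_maps_to hf]
    refine sum_congr rfl fun y _ => ?_
    calc p x * W x y * Real.logb 2 (p x * W x y / (p x * Q y))
        = ∑ c ∈ Γ with f c = y, p x * K x c * Real.logb 2 (p x * W x y / (p x * Q y)) := by
          rw [← sum_mul, ← mul_sum, ← hW]
      _ = _ := sum_congr rfl fun c hc => by rw [(mem_filter.mp hc).2]
  have hlog : 0 < Real.log 2 := Real.log_pos one_lt_two
  have key : ∀ x, ∀ c ∈ Γ, (p x * K x c - ρ c * (p x * W x (f c) / Q (f c))) / Real.log 2 ≤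
      p x * K x c * Real.logb 2 (K x c / ρ c) -
      p x * K x c * Real.logb 2 (p x * W x (f c) / (p x * Q (f c))) := by
    intro x c hc
    by_cases h : p x * K x c = 0
    · rw [h]
      have : 0 ≤ ρ c * (p x * W x (f c) / Q (f c)) :=
        mul_nonneg (hρ0 c) (div_nonneg (mul_nonneg (hp0 x) (hW0 _ _)) (hQ0 _))
      simp only [zero_mul, sub_zero, zero_sub]
      exact div_nonpos_of_nonpos_of_nonneg (by linarith) hlog.le
    · have hρ : 0 < ρ c := lt_of_le_of_ne (hρ0 c) (hac x c h).symm
      have hpx : 0 < p x := lt_of_le_of_ne (hp0 x) fun h' => h (by rw [← h', zero_mul])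
      have hK : 0 < K x c := lt_of_le_of_ne (hK0 x c) fun h' => h (by rw [← h', mul_zero])
      have hWp : 0 < W x (f c) := by
        refine hK.trans_le ?_
        rw [hW]
        exact single_le_sum (f := fun c => K x c) (fun c _ => hK0 x c) (by simp [hc])
      have hQp : 0 < Q (f c) := (mul_pos hpx hWp).trans_le
        (single_le_sum (f := fun x => p x * W x (f c))
          (fun x _ => mul_nonneg (hp0 x) (hW0 _ _)) (mem_univ x))
      rw [mul_div_mul_left _ _ hpx.ne', ← mul_sub, Real.logb, Real.logb, ← sub_div,
        ← mul_div_assoc (p x * K x c)]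
      refine (div_le_div_iff_of_pos_right hlog).mpr ?_
      have h1 := Real.log_le_sub_one_of_pos
        (x := (W x (f c) / Q (f c)) / (K x c / ρ c)) (by positivity)
      rw [Real.log_div (by positivity) (by positivity)] at h1
      have h2 : p x * K x c * ((W x (f c) / Q (f c)) / (K x c / ρ c)) =
          ρ c * (p x * W x (f c) / Q (f c)) := by
        field_simp
      have h3 := mul_le_mul_of_nonneg_left h1 (mul_pos hpx hK).le
      rw [mul_sub _ _ (1 : ℝ), h2] at h3
      linarith
  have hsum : 0 ≤ ∑ x, ∑ c ∈ Γ,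
      (p x * K x c - ρ c * (p x * W x (f c) / Q (f c))) / Real.log 2 := by
    simp_rw [← sum_div, sum_sub_distrib]
    refine div_nonneg (sub_nonneg.mpr ?_) hlog.le
    simp_rw [← mul_sum, hK1, mul_one, hp1]
    rw [sum_comm]
    refine le_trans (sum_le_sum fun c _ => ?_) hρ1
    rw [← mul_sum, ← sum_div]
    exact mul_le_of_le_one_right (hρ0 c) (div_self_le_one _)
  rw [hMI, ← sub_nonneg, ← sum_sub_distrib]
  refine hsum.trans (sum_le_sum fun x _ => ?_)
  rw [← sum_sub_distrib]
  exact sum_le_sum fun c hc => key x c hc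

theorem mem_listsUpTo {n : ℕ} {y : List Bool} : y ∈ listsUpTo n ↔ y.length ≤ n := by
  simp only [listsUpTo, mem_biUnion, mem_range, mem_image, mem_univ, true_and]
  constructor
  · rintro ⟨k, hk, v, rfl⟩
    simp; omega
  · intro h
    exact ⟨y.length, by omega, y.get, List.ofFn_get y⟩

theorem delOutput_mem_listsUpTo {n : ℕ} (x : Fin n → Bool) (S : Finset (Fin n)) :
    delOutput x S ∈ listsUpTo n := by
  rw [mem_listsUpTo]
  simpa [delOutput] using card_le_univ S

theorem Wnk_nonneg (n k : ℕ) (x : Fin n → Bool) (y : List Bool) : 0 ≤ Wnk n k x y :=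
  div_nonneg (sum_nonneg fun _ _ => by split_ifs <;> norm_num) (Nat.cast_nonneg _)

theorem sum_Wnk {n k : ℕ} (hk : k ≤ n) (x : Fin n → Bool) :
    ∑ y ∈ listsUpTo n, Wnk n k x y = 1 := by
  have h : (n.choose k : ℝ) ≠ 0 := by exact_mod_cast (Nat.choose_pos hk).ne'
  simp_rw [Wnk, ← sum_div]
  rw [sum_comm, div_eq_one_iff_eq h]
  simp [delOutput_mem_listsUpTo]

theorem bddAbove_MI_Wnk {n k : ℕ} (hk : k ≤ n) :
    BddAbove { r | ∃ p : (Fin n → Bool) → ℝ, IsDist p ∧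
      r = MI (fun x y => p x * Wnk n k x y) (listsUpTo n) } := by
  refine ⟨∑ x : Fin n → Bool, ∑ y ∈ listsUpTo n,
    |Real.logb 2 (Wnk n k x y / (#(listsUpTo n) : ℝ)⁻¹)|, ?_⟩
  rintro _ ⟨p, hp, rfl⟩
  have hne : (listsUpTo n).Nonempty := ⟨[], by simp [mem_listsUpTo]⟩
  have hc : (#(listsUpTo n) : ℝ) ≠ 0 := by exact_mod_cast hne.card_ne_zero
  have hW : ∀ x, ∀ y ∈ listsUpTo n, Wnk n k x y ≤ 1 := fun x y hy =>
    sum_Wnk hk x ▸ single_le_sum (f := Wnk n k x) (fun y _ => Wnk_nonneg n k x y) hy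
  have hzero : ∀ x y, y ∉ listsUpTo n → Wnk n k x y = 0 := fun x y hy => by
    rw [Wnk, sum_eq_zero, zero_div]
    exact fun S _ => if_neg fun h : _ = y => hy (h ▸ delOutput_mem_listsUpTo x S)
  refine (MI_le_sum_logb hp (listsUpTo n) (listsUpTo n) id (fun _ h => h) (Wnk n k)
    (Wnk_nonneg n k) (sum_Wnk hk) (Wnk n k) (fun x y => ?_) (fun _ => (#(listsUpTo n) : ℝ)⁻¹)
    (fun _ => by positivity) (by simp [hc]) (fun _ _ _ => inv_ne_zero hc)).trans ?_
  · simp only [id, sum_filter, sum_ite_eq']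
    split_ifs with h
    · rfl
    · exact hzero x y h
  · refine sum_le_sum fun x _ => sum_le_sum fun y hy => ?_
    have hp1 : p x ≤ 1 := hp.2 ▸ single_le_sum (f := p) (fun x _ => hp.1 x) (mem_univ x)
    refine (mul_le_mul_of_nonneg_left (le_abs_self _)
      (mul_nonneg (hp.1 x) (Wnk_nonneg n k x y))).trans ?_
    exact mul_le_of_le_one_left (abs_nonneg _)
      (mul_le_one₀ hp1 (Wnk_nonneg n k x y) (hW x y hy))

theorem delOutput_append {s m : ℕ} (x : Fin (s + m) → Bool)
    (A : Finset (Fin s)) (B : Finset (Fin m)) :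
    delOutput x (A.map (Fin.castAddEmb m) ∪ B.map (Fin.natAddEmb s)) =
      delOutput (x ∘ Fin.castAdd m) A ++ delOutput (x ∘ Fin.natAdd s) B := by
  set l := (A.sort (· ≤ ·)).map (Fin.castAdd m) ++ (B.sort (· ≤ ·)).map (Fin.natAdd s) with hl
  have hsorted : l.Pairwise (· < ·) := by
    rw [hl, List.pairwise_append]
    refine ⟨?_, ?_, ?_⟩
    · exact (sortedLT_sort A).pairwise.map _ fun _ _ h => h
    · exact (sortedLT_sort B).pairwise.map _ fun a b h => by simpa using h
    · simp only [List.mem_map]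
      rintro _ ⟨a, -, rfl⟩ _ ⟨b, -, rfl⟩
      simp only [Fin.lt_def, Fin.val_castAdd, Fin.val_natAdd]
      omega
  have hset : A.map (Fin.castAddEmb m) ∪ B.map (Fin.natAddEmb s) = l.toFinset := by
    ext j
    simp [hl]
  have h : (A.map (Fin.castAddEmb m) ∪ B.map (Fin.natAddEmb s)).sort (· ≤ ·) = l := by
    rw [hset]
    exact (List.toFinset_sort (· ≤ ·) (hsorted.imp ne_of_lt)).mpr (hsorted.imp le_of_lt)
  simp [delOutput, h, hl]

theorem sum_powersetCard_fin_add {s m : ℕ} (k : ℕ) (g : Finset (Fin (s + m)) → ℝ) :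
    ∑ S ∈ powersetCard k univ, g S =
      ∑ i ∈ range (s + 1), if i ≤ k then
        ∑ A ∈ powersetCard i univ, ∑ B ∈ powersetCard (k - i) univ,
          g (A.map (Fin.castAddEmb m) ∪ B.map (Fin.natAddEmb s))
      else 0 := by
  let e : Finset (Fin s) × Finset (Fin m) ≃ Finset (Fin (s + m)) :=
    Finset.sumEquiv.symm.toEquiv.trans finSumFinEquiv.finsetCongr
  have he : ∀ A B, e (A, B) = A.map (Fin.castAddEmb m) ∪ B.map (Fin.natAddEmb s) := by
    intro A B
    ext j
    have hne : ∀ (a : Fin s) (b : Fin m), Fin.castAdd m a ≠ Fin.natAdd s b := fun a b h => by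
      have := congrArg Fin.val h
      simp only [Fin.val_castAdd, Fin.val_natAdd] at this
      omega
    induction j using Fin.addCases <;> simp [e, hne, fun a b => (hne a b).symm]
  have hcard : ∀ A B, #(e (A, B)) = #A + #B := by
    intro A B
    simp [e]
  have hfilter : ∀ n j, (powersetCard j (univ : Finset (Fin n))) =
      univ.filter fun S => #S = j := by
    intro n j
    ext S
    simp [mem_powersetCard]
  simp_rw [hfilter, sum_filter]
  rw [← e.sum_comp, Fintype.sum_prod_type]
  simp_rw [hcard, ← he]
  have hswap : ∀ i ∈ range (s + 1), (if i ≤ k then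
      ∑ A : Finset (Fin s), if #A = i then
        ∑ B : Finset (Fin m), if #B = k - i then g (e (A, B)) else 0 else 0 else 0) =
      ∑ A : Finset (Fin s), if #A = i then (if i ≤ k then
        ∑ B : Finset (Fin m), if #B = k - i then g (e (A, B)) else 0 else 0) else 0 := by
    intro i _
    split_ifs <;> simp
  rw [(sum_congr rfl hswap).trans sum_comm]
  refine sum_congr rfl fun A _ => ?_
  have hA : #A < s + 1 := by
    have := card_le_univ A
    simp at this
    omega
  rw [sum_ite_eq, if_pos (mem_range.mpr hA)]
  split_ifs with h
  · refine sum_congr rfl fun B _ => ?_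
    congr 1
    simp only [eq_iff_iff]
    omega
  · exact sum_eq_zero fun B _ => if_neg (by omega)

theorem sum_mul_choose_mul_Wnk (n k : ℕ) (x : Fin n → Bool) (h : List Bool → ℝ) :
    ∑ y ∈ listsUpTo n, h y * (n.choose k * Wnk n k x y) =
      ∑ S ∈ powersetCard k univ, h (delOutput x S) := by
  have hW : ∀ y, n.choose k * Wnk n k x y =
      ∑ S ∈ powersetCard k univ, if delOutput x S = y then (1 : ℝ) else 0 := by
    intro y
    rcases lt_or_ge n k with hk | hk
    · have : powersetCard k (univ : Finset (Fin n)) = ∅ :=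
        powersetCard_eq_empty.mpr (by simpa using hk)
      simp [Nat.choose_eq_zero_of_lt hk, this]
    · exact mul_div_cancel₀ _ (by exact_mod_cast (Nat.choose_pos hk).ne')
  simp_rw [hW, mul_sum]
  rw [sum_comm]
  simp [delOutput_mem_listsUpTo]

/-- The probability that a uniformly random `k`-subset of `s + m` positions has exactly `i`
elements among the first `s` positions. -/
noncomputable def splitProb (s m k i : ℕ) : ℝ :=
  if i ≤ k then (s.choose i * m.choose (k - i) : ℝ) / ((s + m).choose k : ℝ) else 0

theorem splitProb_nonneg (s m k i : ℕ) : 0 ≤ splitProb s m k i := by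
  unfold splitProb
  split_ifs <;> positivity

theorem sum_splitProb {s m k : ℕ} (hk : k ≤ s + m) :
    ∑ i ∈ range (s + 1), splitProb s m k i = 1 := by
  have h : ((s + m).choose k : ℝ) ≠ 0 := by exact_mod_cast (Nat.choose_pos hk).ne'
  have hsum := sum_powersetCard_fin_add (s := s) (m := m) k fun _ => 1
  simp only [sum_const, card_powersetCard, card_univ, Fintype.card_fin, nsmul_eq_mul,
    mul_one] at hsum
  rw [← div_self h]
  conv_rhs => rw [hsum, sum_div]
  refine sum_congr rfl fun i _ => ?_
  simp only [← hsum, splitProb, ite_div, zero_div]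

theorem Wnk_add_eq_sum (s m k : ℕ) (x : Fin (s + m) → Bool) (y : List Bool) :
    Wnk (s + m) k x y =
      ∑ c ∈ range (s + 1) ×ˢ listsUpTo s ×ˢ listsUpTo m with c.2.1 ++ c.2.2 = y,
        splitProb s m k c.1 * (Wnk s c.1 (x ∘ Fin.castAdd m) c.2.1 *
          Wnk m (k - c.1) (x ∘ Fin.natAdd s) c.2.2) := by
  rw [Wnk, sum_powersetCard_fin_add, sum_filter, sum_product, sum_div]
  refine sum_congr rfl fun i _ => ?_
  simp only [sum_product, splitProb]
  split_ifs with hi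
  · simp_rw [delOutput_append]
    rw [← sum_mul_choose_mul_Wnk s i (x ∘ Fin.castAdd m) fun y₁ =>
      ∑ B ∈ powersetCard (k - i) univ,
        if y₁ ++ delOutput (x ∘ Fin.natAdd s) B = y then (1 : ℝ) else 0]
    rw [sum_div]
    refine sum_congr rfl fun y₁ _ => ?_
    rw [← sum_mul_choose_mul_Wnk m (k - i) (x ∘ Fin.natAdd s) fun y₂ =>
      if y₁ ++ y₂ = y then (1 : ℝ) else 0]
    rw [sum_mul, sum_div]
    refine sum_congr rfl fun y₂ _ => ?_
    split_ifs <;> ring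
  · simp

theorem sum_logb_le_Cnk {α : Type*} [Fintype α] {p : α → ℝ} (hp : IsDist p) {n k : ℕ}
    (hk : k ≤ n) (f : α → Fin n → Bool) :
    ∑ x, ∑ y ∈ listsUpTo n, p x * Wnk n k (f x) y *
      Real.logb 2 (Wnk n k (f x) y / ∑ x', p x' * Wnk n k (f x') y) ≤ Cnk n k := by
  classical
  set p' : (Fin n → Bool) → ℝ := fun a => ∑ x with f x = a, p x with hp'
  have hpush : ∀ h : (Fin n → Bool) → ℝ, ∑ a, p' a * h a = ∑ x, p x * h (f x) := by
    intro h
    rw [← sum_fiberwise univ f]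
    refine sum_congr rfl fun a _ => ?_
    rw [hp', sum_mul]
    exact sum_congr rfl fun x hx => by rw [(mem_filter.mp hx).2]
  have hp'0 : ∀ a, 0 ≤ p' a := fun a => sum_nonneg fun x _ => hp.1 x
  have hdist : IsDist p' := ⟨hp'0, by simpa [hp.2] using hpush fun _ => 1⟩
  refine le_csSup_of_le (bddAbove_MI_Wnk hk) ⟨p', hdist, rfl⟩ (le_of_eq ?_)
  simp_rw [mul_assoc, ← mul_sum]
  rw [← hpush fun a => ∑ y ∈ listsUpTo n, Wnk n k a y *
      Real.logb 2 (Wnk n k a y / ∑ x', p x' * Wnk n k (f x') y)]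
  unfold MI
  refine sum_congr rfl fun a _ => ?_
  rw [mul_sum]
  refine sum_congr rfl fun y _ => ?_
  rw [hpush fun a => Wnk n k a y, ← mul_sum, sum_Wnk hk, mul_one]
  by_cases ha : p' a = 0
  · simp [ha]
  · rw [mul_div_mul_left _ _ ha, mul_assoc]

theorem Cnk_add_le {s m k : ℕ} (hk : k ≤ s + m) :
    Cnk (s + m) k ≤
      ∑ i ∈ range (s + 1), splitProb s m k i * (Cnk s i + Cnk m (k - i)) := by
  refine csSup_le ⟨_, Pi.single (fun _ => false) 1, ⟨fun a => ?_, by simp⟩, rfl⟩ ?_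
  · by_cases h : a = fun _ => false <;> simp [h]
  rintro _ ⟨p, hp, rfl⟩
  set W₁ : ℕ → (Fin (s + m) → Bool) → List Bool → ℝ :=
    fun i x => Wnk s i (x ∘ Fin.castAdd m) with hW₁
  set W₂ : ℕ → (Fin (s + m) → Bool) → List Bool → ℝ :=
    fun i x => Wnk m (k - i) (x ∘ Fin.natAdd s) with hW₂
  set r₁ : ℕ → List Bool → ℝ := fun i y => ∑ x, p x * W₁ i x y with hr₁
  set r₂ : ℕ → List Bool → ℝ := fun i y => ∑ x, p x * W₂ i x y with hr₂
  set P := splitProb s m k with hP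
  have hP0 : ∀ i, 0 ≤ P i := splitProb_nonneg s m k
  have hW₁0 : ∀ i x y, 0 ≤ W₁ i x y := fun i x y => Wnk_nonneg _ _ _ _
  have hW₂0 : ∀ i x y, 0 ≤ W₂ i x y := fun i x y => Wnk_nonneg _ _ _ _
  have hr₁0 : ∀ i y, 0 ≤ r₁ i y := fun i y =>
    sum_nonneg fun x _ => mul_nonneg (hp.1 x) (hW₁0 i x y)
  have hr₂0 : ∀ i y, 0 ≤ r₂ i y := fun i y =>
    sum_nonneg fun x _ => mul_nonneg (hp.1 x) (hW₂0 i x y)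
  have hr₁ne : ∀ i x y, p x ≠ 0 → W₁ i x y ≠ 0 → r₁ i y ≠ 0 := fun i x y hx hy h =>
    mul_ne_zero hx hy ((sum_eq_zero_iff_of_nonneg
      fun x _ => mul_nonneg (hp.1 x) (hW₁0 i x y)).mp h x (mem_univ x))
  have hr₂ne : ∀ i x y, p x ≠ 0 → W₂ i x y ≠ 0 → r₂ i y ≠ 0 := fun i x y hx hy h =>
    mul_ne_zero hx hy ((sum_eq_zero_iff_of_nonneg
      fun x _ => mul_nonneg (hp.1 x) (hW₂0 i x y)).mp h x (mem_univ x))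
  have hPle : ∀ i, P i ≠ 0 → i ≤ s ∧ k - i ≤ m := fun i hi => by
    constructor <;> by_contra! h <;>
      exact hi (by simp [hP, splitProb, Nat.choose_eq_zero_of_lt h])
  have hW₁1 : ∀ i, P i ≠ 0 → ∀ x, ∑ y ∈ listsUpTo s, W₁ i x y = 1 := fun i hi x =>
    sum_Wnk (hPle i hi).1 _
  have hW₂1 : ∀ i, P i ≠ 0 → ∀ x, ∑ y ∈ listsUpTo m, W₂ i x y = 1 := fun i hi x =>
    sum_Wnk (hPle i hi).2 _
  have hr₁1 : ∀ i, P i ≠ 0 → ∑ y ∈ listsUpTo s, r₁ i y = 1 := fun i hi => by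
    rw [hr₁, sum_comm]
    simp_rw [← mul_sum, hW₁1 i hi, mul_one, hp.2]
  have hr₂1 : ∀ i, P i ≠ 0 → ∑ y ∈ listsUpTo m, r₂ i y = 1 := fun i hi => by
    rw [hr₂, sum_comm]
    simp_rw [← mul_sum, hW₂1 i hi, mul_one, hp.2]
  have hprod : ∀ F G : ℕ → List Bool → ℝ,
      (∀ i, P i ≠ 0 → ∑ y ∈ listsUpTo s, F i y = 1) →
      (∀ i, P i ≠ 0 → ∑ y ∈ listsUpTo m, G i y = 1) →
      ∑ c ∈ range (s + 1) ×ˢ listsUpTo s ×ˢ listsUpTo m,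
        P c.1 * (F c.1 c.2.1 * G c.1 c.2.2) = 1 := by
    intro F G hF hG
    rw [← sum_splitProb hk, sum_product]
    refine sum_congr rfl fun i _ => ?_
    simp only [← mul_sum, sum_product]
    rw [← sum_mul]
    by_cases hi : P i = 0
    · rw [hi, zero_mul, ← hP, hi]
    · rw [hF i hi, hG i hi, mul_one, mul_one]
  refine (MI_le_sum_logb hp (range (s + 1) ×ˢ listsUpTo s ×ˢ listsUpTo m) (listsUpTo (s + m))
    (fun c => c.2.1 ++ c.2.2) ?_ (fun x c => P c.1 * (W₁ c.1 x c.2.1 * W₂ c.1 x c.2.2))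
    (fun x c => mul_nonneg (hP0 _) (mul_nonneg (hW₁0 _ _ _) (hW₂0 _ _ _)))
    (fun x => hprod (fun i => W₁ i x) (fun i => W₂ i x) (fun i hi => hW₁1 i hi x)
      fun i hi => hW₂1 i hi x) (Wnk (s + m) k) (Wnk_add_eq_sum s m k)
    (fun c => P c.1 * (r₁ c.1 c.2.1 * r₂ c.1 c.2.2))
    (fun c => mul_nonneg (hP0 _) (mul_nonneg (hr₁0 _ _) (hr₂0 _ _)))
    (hprod r₁ r₂ hr₁1 hr₂1).le ?_).trans ?_
  · simp only [mem_product, mem_listsUpTo, List.length_append]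
    omega
  · intro x c h
    simp only [ne_eq, mul_eq_zero, not_or] at h ⊢
    exact ⟨h.2.1, hr₁ne _ _ _ h.1 h.2.2.1, hr₂ne _ _ _ h.1 h.2.2.2⟩
  rw [sum_comm, sum_product]
  refine sum_le_sum fun i _ => ?_
  by_cases hi : P i = 0
  · simp [hi]
  have hterm : ∀ x y₁ y₂, p x * (P i * (W₁ i x y₁ * W₂ i x y₂)) *
      Real.logb 2 (P i * (W₁ i x y₁ * W₂ i x y₂) / (P i * (r₁ i y₁ * r₂ i y₂))) =
      P i * (p x * W₁ i x y₁ * Real.logb 2 (W₁ i x y₁ / r₁ i y₁) * W₂ i x y₂ +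
        W₁ i x y₁ * (p x * W₂ i x y₂ * Real.logb 2 (W₂ i x y₂ / r₂ i y₂))) := by
    intro x y₁ y₂
    by_cases hx : p x = 0
    · simp [hx]
    by_cases h₁ : W₁ i x y₁ = 0
    · simp [h₁]
    by_cases h₂ : W₂ i x y₂ = 0
    · simp [h₂]
    rw [mul_div_mul_left _ _ hi, mul_div_mul_comm, Real.logb_mul
      (div_ne_zero h₁ (hr₁ne i x y₁ hx h₁)) (div_ne_zero h₂ (hr₂ne i x y₂ hx h₂))]
    ring
  have hsplit : ∀ x, ∑ y₁ ∈ listsUpTo s, ∑ y₂ ∈ listsUpTo m,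
      (p x * W₁ i x y₁ * Real.logb 2 (W₁ i x y₁ / r₁ i y₁) * W₂ i x y₂ +
        W₁ i x y₁ * (p x * W₂ i x y₂ * Real.logb 2 (W₂ i x y₂ / r₂ i y₂))) =
      ∑ y₁ ∈ listsUpTo s, p x * W₁ i x y₁ * Real.logb 2 (W₁ i x y₁ / r₁ i y₁) +
      ∑ y₂ ∈ listsUpTo m, p x * W₂ i x y₂ * Real.logb 2 (W₂ i x y₂ / r₂ i y₂) := by
    intro x
    simp_rw [sum_add_distrib]
    rw [← sum_mul_sum, ← sum_mul_sum, hW₁1 i hi x, hW₂1 i hi x, mul_one, one_mul]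
  rw [sum_comm]
  simp_rw [sum_product, hterm, ← mul_sum, hsplit, sum_add_distrib]
  exact mul_le_mul_of_nonneg_left (add_le_add
    (sum_logb_le_Cnk hp (hPle i hi).1 fun x => x ∘ Fin.castAdd m)
    (sum_logb_le_Cnk hp (hPle i hi).2 fun x => x ∘ Fin.natAdd s)) (hP0 i)

/-- For all `0 ≤ k ≤ n` and `1 ≤ s ≤ n`,
`C_{n,k} ≤ Σ_{i=0}^s [C(s,i)·C(n−s,k−i)/C(n,k)] · (C_{s,i} + C_{n−s,k−i})`,
where summands with binomial coefficient `C(s,i)·C(n−s,k−i) = 0` (in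
particular `i > k`, i.e. `k − i < 0`) are taken to be `0`. -/
theorem Cnk_split_bound (n k s : ℕ) (hk : k ≤ n) (hs₁ : 1 ≤ s) (hs₂ : s ≤ n) :
    Cnk n k ≤ ∑ i ∈ Finset.range (s + 1),
      if i ≤ k then
        ((s.choose i * (n - s).choose (k - i) : ℝ) / (n.choose k : ℝ))
          * (Cnk s i + Cnk (n - s) (k - i))
      else 0 := by
  obtain ⟨m, rfl⟩ := Nat.exists_eq_add_of_le hs₂
  rw [Nat.add_sub_cancel_left]
  refine (Cnk_add_le hk).trans (le_of_eq (sum_congr rfl fun i _ => ?_))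
  rw [splitProb, ite_mul, zero_mul]
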